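/- arXiv:2405.17098 — 2 statements merged into one kernel-verified Lean document; each statement's English description precedes it below -/
import Mathlib

section
/- (Exponentiated-weights regret bound, the core estimate behind the paper's Lemma 3 on Politex.) Let τ > 0, M ≥ 0, t ≥ 1, and let q_0, …, q_{t−1} : A → ℝ satisfy 0 ≤ q_i(a) ≤ M for all i and a. Let π_0, …, π_{t−1} be the exponentiated-weights iterates started from the uniform distribution. Then for every comparator action a* ∈ A: Σ_{i<t} q_i(a*) − Σ_{i<t} Σ_{a∈A} π_i(a)·q_i(a) ≤ τ·log|A| + t·M² / (8τ). -/
open Finset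

/-- The probability simplex on a finite type `A`. -/
def probSimplex {A : Type*} [Fintype A] (π : A → ℝ) : Prop :=
  (∀ a, 0 ≤ π a) ∧ ∑ a, π a = 1

/-- **Hoeffding's lemma** for a finitely supported distribution `p`. -/
theorem sum_mul_exp_le_of_mem_Icc {A : Type*} [Fintype A] {p x : A → ℝ} {l u : ℝ}
    (hp : probSimplex p) (hx : ∀ a, x a ∈ Set.Icc l u) (c : ℝ) :
    ∑ a, p a * Real.exp (c * x a) ≤
      Real.exp (c * ∑ a, p a * x a + c ^ 2 * (u - l) ^ 2 / 8) := by
  let _ : MeasurableSpace A := ⊤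
  have hsum : ∑ a, ENNReal.ofReal (p a) = 1 := by
    rw [← ENNReal.ofReal_sum_of_nonneg fun a _ => hp.1 a, hp.2, ENNReal.ofReal_one]
  let P : PMF A := PMF.ofFintype (fun a => ENNReal.ofReal (p a)) hsum
  have hint (f : A → ℝ) : ∫ a, f a ∂P.toMeasure = ∑ a, p a * f a := by
    rw [PMF.integral_eq_sum]
    exact Finset.sum_congr rfl fun a _ => by
      simp [P, PMF.ofFintype_apply, ENNReal.toReal_ofReal (hp.1 a)]
  have h := (ProbabilityTheory.hasSubgaussianMGF_of_mem_Icc (μ := P.toMeasure) (X := x)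
    measurable_from_top.aemeasurable (Filter.Eventually.of_forall hx)).mgf_le c
  rw [ProbabilityTheory.mgf, hint, hint] at h
  calc ∑ a, p a * Real.exp (c * x a)
      = Real.exp (c * ∑ a, p a * x a) *
          ∑ a, p a * Real.exp (c * (x a - ∑ b, p b * x b)) := by
        rw [Finset.mul_sum]
        refine Finset.sum_congr rfl fun a _ => ?_
        rw [mul_left_comm, ← Real.exp_add]
        ring_nf
    _ ≤ _ := mul_le_mul_of_nonneg_left h (Real.exp_pos _).le
    _ = _ := by
        rw [← Real.exp_add]
        congr 2
        push_cast
        rw [Real.norm_eq_abs, div_pow, sq_abs]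
        ring

/-- Exponentiated-weights regret bound (the core estimate behind Lemma 3 on Politex):
if `0 ≤ q i a ≤ M` for all `i < t` and `a`, and `π 0, …, π (t-1)` are the
exponentiated-weights iterates from the uniform distribution, then for every comparator
action `a*`,
`∑_{i<t} q i a* − ∑_{i<t} ∑ a, π i a * q i a ≤ τ * log |A| + t * M² / (8 * τ)`. -/
theorem exponentiated_weights_regret_bound
    {A : Type*} [Fintype A] [Nonempty A]
    (τ : ℝ) (hτ : 0 < τ) (M : ℝ) (hM : 0 ≤ M) (t : ℕ) (ht : 1 ≤ t)
    (q : ℕ → A → ℝ)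
    (hq : ∀ i < t, ∀ a, 0 ≤ q i a ∧ q i a ≤ M)
    (π : ℕ → A → ℝ)
    (hπ0 : ∀ a, π 0 a = 1 / (Fintype.card A : ℝ))
    (hπrec : ∀ i < t, ∀ a,
      π (i + 1) a = π i a * Real.exp (q i a / τ) / ∑ b, π i b * Real.exp (q i b / τ)) :
    ∀ astar : A,
      (∑ i ∈ Finset.range t, q i astar) -
          (∑ i ∈ Finset.range t, ∑ a, π i a * q i a) ≤
        τ * Real.log (Fintype.card A : ℝ) + (t : ℝ) * M ^ 2 / (8 * τ) := by
  intro astar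
  have key : ∀ s ≤ t, (∀ a, 0 < π s a) ∧ ∑ a, π s a = 1 ∧
      (∑ i ∈ Finset.range s, q i astar) - (∑ i ∈ Finset.range s, ∑ a, π i a * q i a) ≤
        τ * Real.log (Fintype.card A : ℝ) + τ * Real.log (π s astar) +
          (s : ℝ) * M ^ 2 / (8 * τ) := by
    intro s
    induction s with
    | zero =>
      intro _
      have hA : (0 : ℝ) < Fintype.card A := by exact_mod_cast Fintype.card_pos
      refine ⟨fun a => by rw [hπ0]; positivity, ?_, ?_⟩
      · simp [hπ0, hA.ne']
      · simp [hπ0]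
    | succ s ih =>
      intro hs
      obtain ⟨hpos, hsum, hregret⟩ := ih (by omega)
      have hrec := hπrec s hs
      set Z := ∑ b, π s b * Real.exp (q s b / τ) with hZ
      have hZpos : 0 < Z :=
        Finset.sum_pos (fun b _ => mul_pos (hpos b) (Real.exp_pos _)) Finset.univ_nonempty
      refine ⟨fun a => ?_, ?_, ?_⟩
      · rw [hrec]
        exact div_pos (mul_pos (hpos a) (Real.exp_pos _)) hZpos
      · simp_rw [hrec]
        rw [← Finset.sum_div, ← hZ, div_self hZpos.ne']
      · have hZle : Z ≤ Real.exp (τ⁻¹ * ∑ a, π s a * q s a + τ⁻¹ ^ 2 * (M - 0) ^ 2 / 8) := by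
          simpa only [hZ, div_eq_inv_mul] using
            sum_mul_exp_le_of_mem_Icc ⟨fun a => (hpos a).le, hsum⟩ (hq s hs) τ⁻¹
        have hlogZ := mul_le_mul_of_nonneg_left
          ((Real.log_le_iff_le_exp hZpos).2 hZle) hτ.le
        have hscale : τ * (τ⁻¹ * ∑ a, π s a * q s a + τ⁻¹ ^ 2 * (M - 0) ^ 2 / 8) =
            ∑ a, π s a * q s a + M ^ 2 / (8 * τ) := by
          field_simp
          ring
        have hlog : τ * Real.log (π (s + 1) astar) =
            τ * Real.log (π s astar) + q s astar - τ * Real.log Z := by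
          rw [hrec, Real.log_div (mul_pos (hpos _) (Real.exp_pos _)).ne' hZpos.ne',
            Real.log_mul (hpos _).ne' (Real.exp_pos _).ne', Real.log_exp]
          field_simp
        have hstep : ((s + 1 : ℕ) : ℝ) * M ^ 2 / (8 * τ) =
            (s : ℝ) * M ^ 2 / (8 * τ) + M ^ 2 / (8 * τ) := by
          push_cast
          ring
        rw [Finset.sum_range_succ, Finset.sum_range_succ, hlog, hstep]
        linarith
  obtain ⟨hpos, hsum, hregret⟩ := key t le_rfl
  have hle : π t astar ≤ 1 :=
    hsum ▸ Finset.single_le_sum (fun a _ => (hpos a).le) (Finset.mem_univ astar)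
  have hlog := mul_nonpos_of_nonneg_of_nonpos hτ.le (Real.log_nonpos (hpos astar).le hle)
  linarith
end

section
/- (Tuned exponentiated-weights regret rate, yielding the O(√(log|A|/t)) rate in the paper's Lemma 3.) Let M > 0, t ≥ 1, and assume |A| ≥ 2. Let q_0, …, q_{t−1} : A → ℝ satisfy 0 ≤ q_i(a) ≤ M for all i and a, and let π_0, …, π_{t−1} be the exponentiated-weights iterates started from the uniform distribution with temperature τ = M·√( t / (8·log|A|) ). Then for every a* ∈ A the average regret satisfies (1/t)·( Σ_{i<t} q_i(a*) − Σ_{i<t} Σ_{a∈A} π_i(a)·q_i(a) ) ≤ M·√( log|A| / (2t) ). -/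
open Finset

open ProbabilityTheory in
/-- **Hoeffding's lemma** for a finitely supported distribution `w` and rewards in `[0, M]`. -/
theorem sum_mul_exp_le_of_mem_Icc_s11 {A : Type*} [Fintype A] {w f : A → ℝ} {M : ℝ}
    (hw : ∀ a, 0 ≤ w a) (hsum : ∑ a, w a = 1) (hf : ∀ a, f a ∈ Set.Icc 0 M) (s : ℝ) :
    ∑ a, w a * Real.exp (s * f a) ≤ Real.exp (s * ∑ a, w a * f a + s ^ 2 * M ^ 2 / 8) := by
  let _ : MeasurableSpace A := ⊤
  have hone : ∑ a, ENNReal.ofReal (w a) = 1 := by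
    rw [← ENNReal.ofReal_sum_of_nonneg fun a _ => hw a, hsum, ENNReal.ofReal_one]
  set p : PMF A := PMF.ofFintype (fun a => ENNReal.ofReal (w a)) hone with hp
  have hint (g : A → ℝ) : ∫ a, g a ∂p.toMeasure = ∑ a, w a * g a := by
    simp [PMF.integral_eq_sum, hp, hw]
  have h := (hasSubgaussianMGF_of_mem_Icc (μ := p.toMeasure) (X := f) (a := 0) (b := M)
    (measurable_from_top.aemeasurable) (Filter.Eventually.of_forall hf)).mgf_le s
  rw [mgf, hint, hint] at h
  set m := ∑ a, w a * f a
  calc ∑ a, w a * Real.exp (s * f a)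
      = Real.exp (s * m) * ∑ a, w a * Real.exp (s * (f a - m)) := by
        rw [Finset.mul_sum]
        refine Finset.sum_congr rfl fun a _ => ?_
        rw [mul_left_comm, ← Real.exp_add]
        ring_nf
    _ ≤ Real.exp (s * m) * Real.exp (s ^ 2 * M ^ 2 / 8) := by
        gcongr
        refine h.trans_eq ?_
        congr 1
        simp [div_pow]
        ring
    _ = _ := (Real.exp_add _ _).symm

/-- Exponentiated-weights iterates stay in the interior of the simplex. -/
theorem exponentiated_weights_pos_and_sum_eq_one {A : Type*} [Fintype A] [Nonempty A]
    {t : ℕ} {q π : ℕ → A → ℝ} {τ : ℝ}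
    (hπ0 : ∀ a, π 0 a = 1 / (Fintype.card A : ℝ))
    (hπrec : ∀ i < t, ∀ a,
      π (i + 1) a = π i a * Real.exp (q i a / τ) / ∑ b, π i b * Real.exp (q i b / τ)) :
    ∀ i ≤ t, (∀ a, 0 < π i a) ∧ ∑ a, π i a = 1 := by
  intro i
  induction i with
  | zero =>
    intro _
    simp [hπ0, Fintype.card_pos]
  | succ i ih =>
    intro hi
    have hpos := (ih (by omega)).1
    have hZ : 0 < ∑ b, π i b * Real.exp (q i b / τ) :=
      Finset.sum_pos (fun b _ => mul_pos (hpos b) (Real.exp_pos _)) Finset.univ_nonempty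
    refine ⟨fun a => ?_, ?_⟩
    · rw [hπrec i hi]
      exact div_pos (mul_pos (hpos a) (Real.exp_pos _)) hZ
    · simp_rw [hπrec i hi]
      rw [← Finset.sum_div, div_self hZ.ne']

/-- Regret bound for exponentiated weights at an arbitrary temperature `τ > 0`. -/
theorem exponentiated_weights_regret_le {A : Type*} [Fintype A] [Nonempty A]
    {M τ : ℝ} (hτ : 0 < τ) {t : ℕ} {q π : ℕ → A → ℝ}
    (hq : ∀ i < t, ∀ a, 0 ≤ q i a ∧ q i a ≤ M)
    (hπ0 : ∀ a, π 0 a = 1 / (Fintype.card A : ℝ))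
    (hπrec : ∀ i < t, ∀ a,
      π (i + 1) a = π i a * Real.exp (q i a / τ) / ∑ b, π i b * Real.exp (q i b / τ))
    (a : A) :
    ∑ i ∈ Finset.range t, q i a - ∑ i ∈ Finset.range t, ∑ b, π i b * q i b ≤
      τ * Real.log (Fintype.card A) + t * (M ^ 2 / (8 * τ)) := by
  have hmem := exponentiated_weights_pos_and_sum_eq_one hπ0 hπrec
  have hstep : ∀ i ∈ Finset.range t, q i a - ∑ b, π i b * q i b ≤
      τ * (Real.log (π (i + 1) a) - Real.log (π i a)) + M ^ 2 / (8 * τ) := by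
    intro i hi
    have hit := Finset.mem_range.1 hi
    obtain ⟨hpos, hsum⟩ := hmem i hit.le
    have hZ : 0 < ∑ b, π i b * Real.exp (q i b / τ) :=
      Finset.sum_pos (fun b _ => mul_pos (hpos b) (Real.exp_pos _)) Finset.univ_nonempty
    have hlogZ : Real.log (∑ b, π i b * Real.exp (q i b / τ)) ≤
        τ⁻¹ * ∑ b, π i b * q i b + τ⁻¹ ^ 2 * M ^ 2 / 8 := by
      rw [Real.log_le_iff_le_exp hZ]
      simpa only [div_eq_inv_mul] using
        sum_mul_exp_le_of_mem_Icc_s11 (fun b => (hpos b).le) hsum (hq i hit) τ⁻¹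
    rw [hπrec i hit, Real.log_div (mul_pos (hpos a) (Real.exp_pos _)).ne' hZ.ne',
      Real.log_mul (hpos a).ne' (Real.exp_pos _).ne', Real.log_exp]
    have hmul := mul_le_mul_of_nonneg_left hlogZ hτ.le
    have hright : τ * (τ⁻¹ * ∑ b, π i b * q i b + τ⁻¹ ^ 2 * M ^ 2 / 8) =
        ∑ b, π i b * q i b + M ^ 2 / (8 * τ) := by
      field_simp
    have hq_div : τ * (q i a / τ) = q i a := mul_div_cancel₀ _ hτ.ne'
    linarith
  have hlog_t : Real.log (π t a) ≤ 0 := by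
    obtain ⟨hpos, hsum⟩ := hmem t le_rfl
    refine Real.log_nonpos (hpos a).le ?_
    rw [← hsum]
    exact Finset.single_le_sum (fun b _ => (hpos b).le) (Finset.mem_univ a)
  have htotal := Finset.sum_le_sum hstep
  rw [Finset.sum_sub_distrib, Finset.sum_add_distrib, ← Finset.mul_sum,
    Finset.sum_range_sub fun i => Real.log (π i a), hπ0, one_div, Real.log_inv,
    Finset.sum_const, Finset.card_range, nsmul_eq_mul] at htotal
  have := mul_nonpos_of_nonneg_of_nonpos hτ.le hlog_t
  linarith

/-- Tuned exponentiated-weights regret rate (the `O(√(log|A|/t))` rate in Lemma 3):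
with `|A| ≥ 2`, rewards `0 ≤ q i a ≤ M`, and temperature
`τ = M * √(t / (8 * log |A|))`, the exponentiated-weights iterates from the uniform
distribution satisfy, for every comparator `a*`,
`(1/t) * (∑_{i<t} q i a* − ∑_{i<t} ∑ a, π i a * q i a) ≤ M * √(log |A| / (2 * t))`. -/
theorem exponentiated_weights_tuned_regret_rate
    {A : Type*} [Fintype A] [Nonempty A] (hA : 2 ≤ Fintype.card A)
    (M : ℝ) (hM : 0 < M) (t : ℕ) (ht : 1 ≤ t)
    (q : ℕ → A → ℝ)
    (hq : ∀ i < t, ∀ a, 0 ≤ q i a ∧ q i a ≤ M)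
    (τ : ℝ)
    (hτ : τ = M * Real.sqrt ((t : ℝ) / (8 * Real.log (Fintype.card A : ℝ))))
    (π : ℕ → A → ℝ)
    (hπ0 : ∀ a, π 0 a = 1 / (Fintype.card A : ℝ))
    (hπrec : ∀ i < t, ∀ a,
      π (i + 1) a = π i a * Real.exp (q i a / τ) / ∑ b, π i b * Real.exp (q i b / τ)) :
    ∀ astar : A,
      (1 / (t : ℝ)) *
          ((∑ i ∈ Finset.range t, q i astar) -
            (∑ i ∈ Finset.range t, ∑ a, π i a * q i a)) ≤
        M * Real.sqrt (Real.log (Fintype.card A : ℝ) / (2 * (t : ℝ))) := by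
  intro a
  have hL : 0 < Real.log (Fintype.card A : ℝ) :=
    Real.log_pos (by exact_mod_cast hA)
  have ht0 : (0 : ℝ) < t := by exact_mod_cast ht
  have hτ0 : 0 < τ := by rw [hτ]; positivity
  have hreg := exponentiated_weights_regret_le hτ0 hq hπ0 hπrec a
  set L := Real.log (Fintype.card A : ℝ)
  have hτsq : τ ^ 2 = M ^ 2 * (t / (8 * L)) := by
    rw [hτ, mul_pow, Real.sq_sqrt (by positivity)]
  have hbalance : t * (M ^ 2 / (8 * τ)) = τ * L := by
    field_simp at hτsq ⊢
    linarith
  have hrate : M * Real.sqrt (L / (2 * t)) = 2 * τ * L / t := by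
    have hsqrt : Real.sqrt (L / (2 * t)) = 2 * τ * L / (t * M) := by
      rw [Real.sqrt_eq_iff_mul_self_eq (by positivity) (by positivity)]
      field_simp at hτsq ⊢
      linarith
    rw [hsqrt]
    field_simp
  rw [hrate, one_div_mul_eq_div]
  gcongr
  linarith
end
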